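/- For every ℓ ≥ 2 and every invertible ℓ×ℓ matrix G over GF(2), there exists an invertible ℓ×ℓ matrix G' over GF(2) whose partial distances satisfy D'_1 ≤ D'_2 ≤ ⋯ ≤ D'_ℓ and ∏_{i=1}^ℓ D'_i ≥ ∏_{i=1}^ℓ D_i, where D_1,…,D_ℓ are the partial distances of G. In particular, E(G') ≥ E(G), so the maximum defining E_ℓ is attained on a matrix with nondecreasing partial distances. -/

import Mathlib

/-- The partial distance `D_i` of the `i`-th row of `G` (0-indexed): the Hamming
distance from row `i` to the GF(2)-linear span of the rows below it. For the last
row the span is `{0}`, so `D_ℓ` is the Hamming weight of the last row. -/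
noncomputable def partialDist {ℓ : ℕ} (G : Matrix (Fin ℓ) (Fin ℓ) (ZMod 2)) (i : Fin ℓ) : ℕ :=
  sInf {d : ℕ | ∃ c ∈ Submodule.span (ZMod 2) {v : Fin ℓ → ZMod 2 | ∃ j, i < j ∧ v = G j},
    d = hammingDist (G i) c}

/-- The exponent `E(G) = (1/ℓ) ∑_i log_ℓ D_i`. -/
noncomputable def expE {ℓ : ℕ} (G : Matrix (Fin ℓ) (Fin ℓ) (ZMod 2)) : ℝ :=
  (1 / ℓ : ℝ) * ∑ i, Real.logb ℓ (partialDist G i)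

/-- `E_ℓ`: the maximum of `E(G)` over invertible `ℓ×ℓ` matrices over GF(2). -/
noncomputable def Emax (ℓ : ℕ) : ℝ :=
  sSup {x : ℝ | ∃ G : Matrix (Fin ℓ) (Fin ℓ) (ZMod 2), IsUnit G ∧ x = expE G}

lemma partialDist_le {ℓ : ℕ} (G : Matrix (Fin ℓ) (Fin ℓ) (ZMod 2)) (i : Fin ℓ)
    {c : Fin ℓ → ZMod 2}
    (hc : c ∈ Submodule.span (ZMod 2) {v : Fin ℓ → ZMod 2 | ∃ j, i < j ∧ v = G j}) :
    partialDist G i ≤ hammingDist (G i) c :=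
  Nat.sInf_le ⟨c, hc, rfl⟩

lemma exists_partialDist_eq {ℓ : ℕ} (G : Matrix (Fin ℓ) (Fin ℓ) (ZMod 2)) (i : Fin ℓ) :
    ∃ c ∈ Submodule.span (ZMod 2) {v : Fin ℓ → ZMod 2 | ∃ j, i < j ∧ v = G j},
      partialDist G i = hammingDist (G i) c :=
  Nat.sInf_mem (s := {d : ℕ | ∃ c ∈ Submodule.span (ZMod 2)
    {v : Fin ℓ → ZMod 2 | ∃ j, i < j ∧ v = G j}, d = hammingDist (G i) c})
    ⟨_, 0, Submodule.zero_mem _, rfl⟩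

lemma partialDist_pos {ℓ : ℕ} {G : Matrix (Fin ℓ) (Fin ℓ) (ZMod 2)} (hG : IsUnit G)
    (i : Fin ℓ) : 0 < partialDist G i := by
  obtain ⟨c, hc, h⟩ := exists_partialDist_eq G i
  rw [h, hammingDist_pos]
  rintro rfl
  have hli : LinearIndependent (ZMod 2) G.row := Matrix.linearIndependent_rows_iff_isUnit.mpr hG
  refine hli.notMem_span_image (s := Set.Ioi i) (x := i) (by simp) ?_
  refine Submodule.span_mono ?_ hc
  rintro v ⟨j, hj, rfl⟩
  exact ⟨j, hj, rfl⟩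

/-- Swapping two adjacent rows whose partial distances are in decreasing order does not decrease
the partial distance attached to any row. -/
lemma partialDist_le_swap {ℓ : ℕ} (G : Matrix (Fin ℓ) (Fin ℓ) (ZMod 2)) {i j : Fin ℓ}
    (hij : i ⋖ j) (hlt : partialDist G j < partialDist G i) (k : Fin ℓ) :
    partialDist G k ≤ partialDist (G.submatrix (Equiv.swap i j) id) (Equiv.swap i j k) := by
  set σ := Equiv.swap i j with hσ
  have hrow (m : Fin ℓ) : G.submatrix σ id m = G (σ m) := rfl
  have hσσ (m : Fin ℓ) : σ (σ m) = m := Equiv.swap_apply_self i j m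
  have hval : i.val + 1 = j.val := by
    have h1 : i < j := hij.lt
    by_contra hne
    exact hij.2 (c := ⟨i.val + 1, by omega⟩) (Fin.lt_def.mpr (by simp))
      (Fin.lt_def.mpr (by simp only; omega))
  obtain ⟨c, hc, h⟩ := exists_partialDist_eq (G.submatrix σ id) (σ k)
  rw [h, hrow, hσσ]
  by_cases hk : k = j
  · subst hk
    have hset : {v : Fin ℓ → ZMod 2 | ∃ m, σ k < m ∧ v = G.submatrix σ id m} ⊆
        insert (G i) {v | ∃ m, k < m ∧ v = G m} := by
      rintro v ⟨m, hm, rfl⟩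
      rw [hσ, Equiv.swap_apply_right] at hm
      rw [hrow]
      by_cases hmk : m = k
      · left
        rw [hmk, hσ, Equiv.swap_apply_right]
      · right
        refine ⟨m, by omega, ?_⟩
        rw [hσ, Equiv.swap_apply_of_ne_of_ne hm.ne' hmk]
    obtain ⟨a, s, hs, rfl⟩ := Submodule.mem_span_insert.mp (Submodule.span_mono hset hc)
    obtain rfl | rfl : a = 0 ∨ a = 1 :=
      (by decide : ∀ b : ZMod 2, b = 0 ∨ b = 1) a
    · simpa using partialDist_le G k hs
    · have hmem : G k - s ∈
          Submodule.span (ZMod 2) {v : Fin ℓ → ZMod 2 | ∃ m, i < m ∧ v = G m} := by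
        refine Submodule.sub_mem _ (Submodule.subset_span ⟨k, hij.lt, rfl⟩)
          (Submodule.span_mono ?_ hs)
        rintro v ⟨m, hm, rfl⟩
        exact ⟨m, hij.lt.trans hm, rfl⟩
      refine hlt.le.trans ((partialDist_le G i hmem).trans_eq ?_)
      rw [one_smul, hammingDist_comm, hammingDist_eq_hammingNorm, hammingDist_eq_hammingNorm]
      congr 1
      abel
  · refine partialDist_le G k (Submodule.span_mono ?_ hc)
    rintro v ⟨m, hm, rfl⟩
    refine ⟨σ m, ?_, rfl⟩
    simp only [hσ, Equiv.swap_apply_def] at hm ⊢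
    split_ifs at hm ⊢ <;> omega

lemma sum_val_mul_partialDist_lt_swap {ℓ : ℕ} (G : Matrix (Fin ℓ) (Fin ℓ) (ZMod 2))
    {i j : Fin ℓ} (hij : i ⋖ j) (hlt : partialDist G j < partialDist G i) :
    ∑ k : Fin ℓ, k.val * partialDist G k <
      ∑ k : Fin ℓ, k.val * partialDist (G.submatrix (Equiv.swap i j) id) k := by
  rw [← Equiv.sum_comp (Equiv.swap i j)
    (fun k : Fin ℓ => k.val * partialDist (G.submatrix (Equiv.swap i j) id) k)]
  refine lt_of_lt_of_le ?_ (Finset.sum_le_sum fun k _ =>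
    Nat.mul_le_mul_left _ (partialDist_le_swap G hij hlt k))
  zify
  rw [← sub_pos, ← Finset.sum_sub_distrib, Fintype.sum_eq_add i j hij.lt.ne]
  · rw [Equiv.swap_apply_left, Equiv.swap_apply_right]
    have h1 : (i.val : ℤ) < j.val := by exact_mod_cast hij.lt
    have h2 : (partialDist G j : ℤ) < partialDist G i := by exact_mod_cast hlt
    nlinarith [mul_pos (sub_pos.mpr h1) (sub_pos.mpr h2)]
  · rintro k ⟨hki, hkj⟩
    rw [Equiv.swap_apply_of_ne_of_ne hki hkj, sub_self]

lemma expE_le_expE_of_prod_le {ℓ : ℕ} (hℓ : 2 ≤ ℓ) {G G' : Matrix (Fin ℓ) (Fin ℓ) (ZMod 2)}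
    (hG : IsUnit G) (hG' : IsUnit G') (h : ∏ i, partialDist G i ≤ ∏ i, partialDist G' i) :
    expE G ≤ expE G' := by
  have hne {H : Matrix (Fin ℓ) (Fin ℓ) (ZMod 2)} (hH : IsUnit H) (i : Fin ℓ)
      (_ : i ∈ Finset.univ) : (partialDist H i : ℝ) ≠ 0 :=
    Nat.cast_ne_zero.mpr (partialDist_pos hH i).ne'
  unfold expE
  refine mul_le_mul_of_nonneg_left ?_ (by positivity)
  rw [← Real.logb_prod _ _ (hne hG), ← Real.logb_prod _ _ (hne hG')]
  refine Real.logb_le_logb_of_le (by exact_mod_cast hℓ) ?_ (by exact_mod_cast h)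
  exact Finset.prod_pos fun i _ => Nat.cast_pos.mpr (partialDist_pos hG i)

/-- Corollary 8: for every invertible `G` there is an invertible `G'` with
nondecreasing partial distances, at least as large a product of partial distances,
and `E(G') ≥ E(G)`; hence the maximum defining `E_ℓ` is attained on matrices with
nondecreasing partial distances. -/
theorem stmt5 (ℓ : ℕ) (hℓ : 2 ≤ ℓ) (G : Matrix (Fin ℓ) (Fin ℓ) (ZMod 2)) (hG : IsUnit G) :
    ∃ G' : Matrix (Fin ℓ) (Fin ℓ) (ZMod 2), IsUnit G' ∧
      (∀ i j : Fin ℓ, i ≤ j → partialDist G' i ≤ partialDist G' j) ∧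
      (∏ i, partialDist G i) ≤ (∏ i, partialDist G' i) ∧
      expE G ≤ expE G' := by
  obtain ⟨H, ⟨hH, hprod⟩, hmax⟩ := Set.exists_max_image
    {H : Matrix (Fin ℓ) (Fin ℓ) (ZMod 2) |
      IsUnit H ∧ ∏ i, partialDist G i ≤ ∏ i, partialDist H i}
    (fun H => ∑ k : Fin ℓ, k.val * partialDist H k) (Set.toFinite _) ⟨G, hG, le_rfl⟩
  refine ⟨H, hH, ?_, hprod, expE_le_expE_of_prod_le hℓ hG hH hprod⟩
  suffices hmono : Monotone (partialDist H) from fun i j hij => hmono hij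
  rw [monotone_iff_forall_covBy]
  intro i j hij
  by_contra! hlt
  refine (sum_val_mul_partialDist_lt_swap H hij hlt).not_ge (hmax _ ⟨?_, hprod.trans ?_⟩)
  · exact (Matrix.isUnit_submatrix_equiv (Equiv.swap i j) (Equiv.refl _)).mpr hH
  · rw [← Equiv.prod_comp (Equiv.swap i j)
      (partialDist (H.submatrix (Equiv.swap i j) id))]
    exact Finset.prod_le_prod' fun k _ => partialDist_le_swap H hij hlt k
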